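/- arXiv:math/9312209 — 5 statements merged into one kernel-verified Lean document; each statement's English description precedes it below -/
import Mathlib

section
/- Let K be a separable metric space and let f : K → ℝ be a bounded function. Then f ∈ B_{1/2}(K) if and only if for every ε > 0 there exists n with os_n(f,ε) = ∅. -/
open Filter Topology Set

noncomputable section

/-- A real-valued function is bounded. -/
def BddFun {X : Type*} (f : X → ℝ) : Prop := ∃ C, ∀ x, |f x| ≤ C

/-- `f ∈ DBSC(X)`: `f` is a difference of bounded lower semicontinuous functions. -/
def MemDBSC {X : Type*} [TopologicalSpace X] (f : X → ℝ) : Prop :=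
  ∃ u v : X → ℝ, BddFun u ∧ BddFun v ∧ LowerSemicontinuous u ∧ LowerSemicontinuous v ∧
    f = u - v

/-- The D-norm of `f`. -/
def DNorm {X : Type*} [TopologicalSpace X] (f : X → ℝ) : ℝ :=
  sInf {c | ∃ φ : ℕ → X → ℝ, (∀ j, Continuous (φ j)) ∧ (∀ x, Summable fun j => |φ j x|) ∧
    (∀ x, ∑' j, φ j x = f x) ∧ (∀ x, ∑' j, |φ j x| ≤ c)}

/-- The sup-norm of `f`. -/
def supNorm {X : Type*} (f : X → ℝ) : ℝ := ⨆ x, |f x|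

/-- A simple D-function: a D-function taking finitely many values. -/
def SimpleD {X : Type*} [TopologicalSpace X] (f : X → ℝ) : Prop :=
  MemDBSC f ∧ (Set.range f).Finite

/-- `f ∈ SD(X)`: `f` is a strong D-function. -/
def MemSD {X : Type*} [TopologicalSpace X] (f : X → ℝ) : Prop :=
  ∃ φ : ℕ → X → ℝ, (∀ n, SimpleD (φ n)) ∧
    Tendsto (fun n => DNorm (f - φ n)) atTop (𝓝 0)

/-- `f ∈ B_{1/2}(X)`: `f` is a uniform limit of D-functions. -/
def MemBHalf {X : Type*} [TopologicalSpace X] (f : X → ℝ) : Prop :=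
  ∃ g : ℕ → X → ℝ, (∀ n, MemDBSC (g n)) ∧ TendstoUniformly g f atTop

/-- The upper semicontinuous envelope `Uf`. -/
def uEnv {X : Type*} [TopologicalSpace X] (f : X → ℝ) (x : X) : ℝ :=
  sInf {c | ∃ V : Set X, IsOpen V ∧ x ∈ V ∧ sSup (f '' V) = c}

/-- The lower oscillation of `f` at `x`. -/
def losc {X : Type*} [TopologicalSpace X] (f : X → ℝ) (x : X) : ℝ :=
  sInf {c | ∃ V : Set X, IsOpen V ∧ x ∈ V ∧ sSup ((fun y => |f y - f x|) '' V) = c}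

/-- The oscillation of `f`: `osc f = U (losc f)`. -/
def osc {X : Type*} [TopologicalSpace X] (f : X → ℝ) : X → ℝ := uEnv (losc f)

/-- The oscillation sets `os_n(f, ε)`. -/
def osSet {X : Type*} [TopologicalSpace X] (f : X → ℝ) (ε : ℝ) : ℕ → Set X
  | 0 => Set.univ
  | n + 1 => {x | ∃ h : x ∈ osSet f ε n, ε ≤ osc ((osSet f ε n).restrict f) ⟨x, h⟩}

/-- The `ε`-oscillation index `i(f, ε) = sup {n : os_n(f,ε) ≠ ∅}`. -/
def oscIndex {X : Type*} [TopologicalSpace X] (f : X → ℝ) (ε : ℝ) : ℕ∞ :=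
  ⨆ (m : ℕ) (_ : (osSet f ε m).Nonempty), (m : ℕ∞)

/-- `f` has finite Baire index. -/
def FiniteBaireIndex {X : Type*} [TopologicalSpace X] (f : X → ℝ) : Prop :=
  ∃ n : ℕ, ∀ ε > 0, osSet f ε n = ∅

/-- The Baire index `i(f) = sup_{ε > 0} i(f, ε)`. -/
def baireIndex {X : Type*} [TopologicalSpace X] (f : X → ℝ) : ℕ∞ :=
  ⨆ (ε : ℝ) (_ : 0 < ε), oscIndex f ε

open scoped ENNReal

lemma BddFun.abs_sub_const {X : Type*} {f : X → ℝ} (hf : BddFun f) (a : ℝ) :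
    BddFun fun y => |f y - a| := by
  obtain ⟨C, hC⟩ := hf
  refine ⟨C + |a|, fun y => ?_⟩
  rw [abs_abs]
  linarith [abs_sub (f y) a, hC y]

lemma BddFun.restrict {X : Type*} {f : X → ℝ} (hf : BddFun f) (s : Set X) : BddFun (s.restrict f) :=
  hf.imp fun _ hC x => hC x

lemma BddFun.add {X : Type*} {f g : X → ℝ} (hf : BddFun f) (hg : BddFun g) : BddFun (f + g) := by
  obtain ⟨C, hC⟩ := hf
  obtain ⟨D, hD⟩ := hg
  exact ⟨C + D, fun x => (abs_add_le _ _).trans (add_le_add (hC x) (hD x))⟩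

section Oscillation

variable {X : Type*} [TopologicalSpace X]

lemma uEnv_lt_iff {f : X → ℝ} (hf : BddFun f) {x : X} {c : ℝ} :
    uEnv f x < c ↔ ∃ d < c, ∀ᶠ y in 𝓝 x, f y ≤ d := by
  obtain ⟨C, hC⟩ := hf
  have hbdd : ∀ V : Set X, BddAbove (f '' V) := fun V =>
    ⟨C, by rintro _ ⟨y, -, rfl⟩; exact (abs_le.1 (hC y)).2⟩
  constructor
  · intro h
    obtain ⟨_, ⟨V, hV, hxV, rfl⟩, hlt⟩ :=
      exists_lt_of_csInf_lt (by exact ⟨_, univ, isOpen_univ, mem_univ x, rfl⟩) h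
    refine ⟨_, hlt, ?_⟩
    filter_upwards [hV.mem_nhds hxV] with y hy
    exact le_csSup (hbdd V) (mem_image_of_mem f hy)
  · rintro ⟨d, hdc, hd⟩
    obtain ⟨V, hVd, hV, hxV⟩ := eventually_nhds_iff.1 hd
    refine lt_of_le_of_lt (csInf_le_of_le ⟨-C, ?_⟩ ⟨V, hV, hxV, rfl⟩ ?_) hdc
    · rintro _ ⟨W, -, hxW, rfl⟩
      exact (abs_le.1 (hC x)).1.trans (le_csSup (hbdd W) (mem_image_of_mem f hxW))
    · refine csSup_le ((nonempty_of_mem hxV).image f) ?_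
      rintro _ ⟨y, hy, rfl⟩
      exact hVd y hy

lemma isOpen_setOf_uEnv_lt {f : X → ℝ} (hf : BddFun f) (c : ℝ) :
    IsOpen {x | uEnv f x < c} := by
  rw [isOpen_iff_mem_nhds]
  intro x hx
  obtain ⟨d, hdc, hd⟩ := (uEnv_lt_iff hf).1 hx
  filter_upwards [eventually_eventually_nhds.2 hd] with y hy
  exact (uEnv_lt_iff hf).2 ⟨d, hdc, hy⟩

lemma le_uEnv {f : X → ℝ} (hf : BddFun f) (x : X) : f x ≤ uEnv f x := by
  by_contra! h
  obtain ⟨d, hd, hle⟩ := (uEnv_lt_iff hf).1 h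
  exact hd.not_ge hle.self_of_nhds

lemma losc_lt_iff {f : X → ℝ} (hf : BddFun f) {x : X} {c : ℝ} :
    losc f x < c ↔ ∃ d < c, ∀ᶠ y in 𝓝 x, |f y - f x| ≤ d :=
  uEnv_lt_iff (hf.abs_sub_const (f x))

lemma bddFun_losc {f : X → ℝ} (hf : BddFun f) : BddFun (losc f) := by
  have ⟨C, hC⟩ := hf
  refine ⟨2 * C, fun x => abs_le.2 ⟨?_, ?_⟩⟩
  · have h := le_uEnv (hf.abs_sub_const (f x)) x
    have h' : |f x - f x| ≤ losc f x := h
    linarith [abs_nonneg (f x - f x), abs_nonneg (f x), hC x]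
  · refine le_of_forall_gt fun c hc => (losc_lt_iff hf).2 ⟨2 * C, hc, ?_⟩
    refine Eventually.of_forall fun y => ?_
    linarith [abs_sub (f y) (f x), hC x, hC y]

lemma eventually_abs_sub_lt_of_osc_lt {f : X → ℝ} (hf : BddFun f) {x : X} {ε : ℝ}
    (h : osc f x < ε) : ∀ᶠ y in 𝓝 x, |f y - f x| < ε := by
  obtain ⟨d, hd, hle⟩ := (losc_lt_iff hf).1 ((le_uEnv (bddFun_losc hf) x).trans_lt h)
  exact hle.mono fun y hy => hy.trans_lt hd

lemma frequently_frequently_lt_of_le_osc {f : X → ℝ} (hf : BddFun f) {x : X} {d ε : ℝ}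
    (h : ε ≤ osc f x) (hd : d < ε) : ∃ᶠ y in 𝓝 x, ∃ᶠ z in 𝓝 y, d < |f z - f y| := by
  intro hcon
  obtain ⟨e, hde, heε⟩ := exists_between hd
  refine h.not_gt ((uEnv_lt_iff (bddFun_losc hf)).2 ⟨e, heε, hcon.mono fun y hy => ?_⟩)
  exact ((losc_lt_iff hf).2 ⟨d, hde, (not_frequently.1 hy).mono fun z hz => not_lt.1 hz⟩).le

/-- Near a point of large oscillation of a uniform perturbation of `u - v`, the function `u + v`
increases by a definite amount. -/
lemma exists_add_le_add_of_le_osc {f u v : X → ℝ} (hf : BddFun f)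
    (hu : LowerSemicontinuous u) (hv : LowerSemicontinuous v) {ε : ℝ} (hε : 0 < ε)
    (hfuv : ∀ x, |f x - (u x - v x)| < ε / 8) {x : X} (hx : ε ≤ osc f x) :
    ∃ z, u x + v x + ε / 16 ≤ u z + v z := by
  obtain ⟨y, hy, hxy⟩ := ((frequently_frequently_lt_of_le_osc hf hx (half_lt_self hε)).and_eventually
    ((hu.add hv) x (u x + v x - ε / 16) (by linarith))).exists
  obtain ⟨z, ⟨hz, huz⟩, hvz⟩ := ((hy.and_eventually
    (hu y (u y - ε / 16) (by linarith))).and_eventually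
    (hv y (v y - ε / 16) (by linarith))).exists
  refine ⟨z, ?_⟩
  have h₁ := abs_lt.1 (hfuv y)
  have h₂ := abs_lt.1 (hfuv z)
  rcases lt_abs.1 hz with h | h <;> linarith

lemma osSet_succ_subset (f : X → ℝ) (ε : ℝ) (n : ℕ) : osSet f ε (n + 1) ⊆ osSet f ε n :=
  fun _ ⟨h, _⟩ => h

lemma isClosed_osSet {f : X → ℝ} (hf : BddFun f) (ε : ℝ) (n : ℕ) : IsClosed (osSet f ε n) := by
  induction n with
  | zero => exact isClosed_univ
  | succ n ih =>
    have h : osSet f ε (n + 1) =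
        Subtype.val '' {x | osc ((osSet f ε n).restrict f) x < ε}ᶜ := by
      ext x
      constructor
      · rintro ⟨hx, hosc⟩
        exact ⟨⟨x, hx⟩, not_lt.2 hosc, rfl⟩
      · rintro ⟨⟨x, hx⟩, hosc, rfl⟩
        exact ⟨hx, not_lt.1 hosc⟩
    rw [h]
    exact ih.isClosedEmbedding_subtypeVal.isClosedMap _
      (isOpen_setOf_uEnv_lt (bddFun_losc (hf.restrict _)) ε).isClosed_compl

/-- Points at which `f` is within `ε` of nearby values on `osSet f ε n`. -/
lemma eventually_abs_sub_lt_of_mem_osSet {f : X → ℝ} (hf : BddFun f) {ε : ℝ} {n : ℕ} {x : X}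
    (hx : x ∈ osSet f ε n) (hx' : x ∉ osSet f ε (n + 1)) :
    ∀ᶠ y in 𝓝 x, y ∈ osSet f ε n → |f y - f x| < ε := by
  have h : osc ((osSet f ε n).restrict f) ⟨x, hx⟩ < ε := by
    by_contra! hle
    exact hx' ⟨hx, hle⟩
  have := eventually_abs_sub_lt_of_osc_lt (hf.restrict _) h
  rw [nhds_subtype_eq_comap, eventually_comap] at this
  exact this.mono fun y hy hyL => hy ⟨y, hyL⟩ rfl

end Oscillation

section DBSC

variable {X : Type*} [TopologicalSpace X]

lemma MemDBSC.zero : MemDBSC (0 : X → ℝ) :=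
  ⟨0, 0, ⟨0, by simp⟩, ⟨0, by simp⟩, lowerSemicontinuous_const, lowerSemicontinuous_const,
    by simp⟩

lemma MemDBSC.neg {f : X → ℝ} (hf : MemDBSC f) : MemDBSC (-f) := by
  obtain ⟨u, v, hu, hv, hu', hv', rfl⟩ := hf
  exact ⟨v, u, hv, hu, hv', hu', neg_sub u v⟩

lemma MemDBSC.add {f g : X → ℝ} (hf : MemDBSC f) (hg : MemDBSC g) : MemDBSC (f + g) := by
  obtain ⟨u, v, hu, hv, hu', hv', rfl⟩ := hf
  obtain ⟨s, t, hs, ht, hs', ht', rfl⟩ := hg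
  exact ⟨u + s, v + t, hu.add hs, hv.add ht, hu'.add hs', hv'.add ht', sub_add_sub_comm u v s t⟩

lemma IsOpen.lowerSemicontinuous_indicator_of_continuousOn {s : Set X} (hs : IsOpen s)
    {φ : X → ℝ} (hφ : ContinuousOn φ s) (h0 : ∀ x ∈ s, 0 ≤ φ x) :
    LowerSemicontinuous (s.indicator φ) := by
  intro x c hc
  by_cases hx : x ∈ s
  · rw [indicator_of_mem hx] at hc
    filter_upwards [hs.mem_nhds hx, (hφ.continuousAt (hs.mem_nhds hx)).eventually_const_lt hc]
      with y hy hcy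
    rwa [indicator_of_mem hy]
  · rw [indicator_of_notMem hx] at hc
    exact Eventually.of_forall fun y => hc.trans_le (indicator_nonneg h0 y)

lemma memDBSC_indicator {s : Set X} (hs : IsOpen s) {φ : X → ℝ} (hφ : ContinuousOn φ s) {C : ℝ}
    (hC : ∀ x ∈ s, |φ x| ≤ C) : MemDBSC (s.indicator φ) := by
  refine ⟨s.indicator fun x => φ x + |C|, s.indicator fun _ => |C|, ⟨C + |C| + |C|, fun x => ?_⟩,
    ⟨|C|, fun x => ?_⟩, hs.lowerSemicontinuous_indicator_of_continuousOn
      (hφ.add continuousOn_const) fun x hx => ?_,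
    hs.lowerSemicontinuous_indicator (abs_nonneg C), ?_⟩
  · by_cases hx : x ∈ s
    · rw [indicator_of_mem hx, abs_le]
      have h₁ := abs_le.1 (hC x hx)
      constructor <;> linarith [abs_nonneg C]
    · rw [indicator_of_notMem hx, abs_zero]
      linarith [neg_abs_le C, abs_nonneg C]
  · by_cases hx : x ∈ s <;> simp [hx]
  · linarith [(abs_le.1 (hC x hx)).1, le_abs_self C]
  · ext x
    by_cases hx : x ∈ s <;> simp [hx]

end DBSC

lemma exists_osSet_eq_empty_of_memBHalf {X : Type*} [TopologicalSpace X] {f : X → ℝ}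
    (hb : BddFun f) (hf : MemBHalf f) {ε : ℝ} (hε : 0 < ε) : ∃ n, osSet f ε n = ∅ := by
  obtain ⟨g, hg, hgf⟩ := hf
  obtain ⟨m, hm⟩ := (Metric.tendstoUniformly_iff.1 hgf (ε / 8) (by positivity)).exists
  obtain ⟨u, v, ⟨A, hA⟩, ⟨B, hB⟩, hu, hv, huv⟩ := hg m
  have hclose : ∀ x, |f x - (u x - v x)| < ε / 8 := fun x => by
    have h := hm x
    rwa [huv, Real.dist_eq] at h
  have hgrow : ∀ n, ∀ x ∈ osSet f ε n, ∃ z, u x + v x + n * (ε / 16) ≤ u z + v z := by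
    intro n
    induction n with
    | zero => exact fun x _ => ⟨x, by simp⟩
    | succ n ih =>
      rintro x ⟨hx, hosc⟩
      obtain ⟨y, hy⟩ := exists_add_le_add_of_le_osc (hb.restrict _)
        (hu.comp continuous_subtype_val) (hv.comp continuous_subtype_val) hε
        (fun y => hclose y) hosc
      obtain ⟨z, hz⟩ := ih y y.2
      refine ⟨z, ?_⟩
      simp only [Function.comp_apply] at hy
      push_cast
      linarith
  obtain ⟨n, hn⟩ := exists_nat_gt (2 * (A + B) / (ε / 16))
  rw [div_lt_iff₀ (by positivity)] at hn
  refine ⟨n, eq_empty_of_forall_notMem fun x hx => ?_⟩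
  obtain ⟨z, hz⟩ := hgrow n x hx
  linarith [abs_le.1 (hA x), abs_le.1 (hB x), abs_le.1 (hA z), abs_le.1 (hB z)]

section Approximation

variable {K : Type*} [MetricSpace K] {f : K → ℝ}

/-- On the complement of `osSet f ε (n + 1)` there is a bounded continuous function which is
`ε`-close to `f` on `osSet f ε n`. -/
lemma exists_continuousOn_compl_osSet {C : ℝ} (hC : ∀ x, |f x| ≤ C) (ε : ℝ) (n : ℕ) :
    ∃ φ : K → ℝ, ContinuousOn φ (osSet f ε (n + 1))ᶜ ∧
      ∀ x ∈ (osSet f ε (n + 1))ᶜ, |φ x| ≤ C ∧ (x ∈ osSet f ε n → |f x - φ x| < ε) := by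
  have hf : BddFun f := ⟨C, hC⟩
  set U := (osSet f ε (n + 1))ᶜ
  let t : U → Set ℝ := fun x =>
    Metric.closedBall 0 C ∩ {c | (x : K) ∈ osSet f ε n → c ∈ Metric.ball (f x) ε}
  have ht : ∀ x, Convex ℝ (t x) := by
    intro x
    refine (convex_closedBall 0 C).inter ?_
    by_cases hx : (x : K) ∈ osSet f ε n
    · simpa only [hx, true_imp_iff, ofPred_mem_eq] using convex_ball (f x) ε
    · simpa [hx] using convex_univ
  have hloc : ∀ x : U, ∃ c : ℝ, ∀ᶠ y in 𝓝 x, c ∈ t y := by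
    intro x
    refine ⟨f x, ?_⟩
    have hev : ∀ᶠ y in 𝓝 (x : K), y ∈ osSet f ε n → |f y - f x| < ε := by
      by_cases hx : (x : K) ∈ osSet f ε n
      · exact eventually_abs_sub_lt_of_mem_osSet hf hx x.2
      · filter_upwards [(isClosed_osSet hf ε n).isOpen_compl.mem_nhds hx] with y hy hy'
        exact absurd hy' hy
    filter_upwards [continuous_subtype_val.continuousAt.eventually hev] with y hy
    refine ⟨by simpa using hC x, fun hyL => ?_⟩
    rw [Metric.mem_ball, dist_comm, Real.dist_eq]
    exact hy hyL
  obtain ⟨φ, hφ⟩ := exists_continuous_forall_mem_convex_of_local_const ht hloc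
  refine ⟨Function.extend Subtype.val φ 0, ?_, fun x hx => ?_⟩
  · rw [continuousOn_iff_continuous_domRestrict]
    convert φ.continuous using 1
    ext x
    exact Subtype.val_injective.extend_apply φ 0 x
  · have hext : Function.extend Subtype.val φ 0 x = φ ⟨x, hx⟩ :=
      Subtype.val_injective.extend_apply φ 0 ⟨x, hx⟩
    rw [hext]
    refine ⟨by simpa using (hφ ⟨x, hx⟩).1, fun hxL => ?_⟩
    have h := (hφ ⟨x, hx⟩).2 hxL
    rwa [Metric.mem_ball, dist_comm, Real.dist_eq] at h

lemma exists_memDBSC_close_off_osSet (hf : BddFun f) (ε : ℝ) (n : ℕ) :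
    ∃ g : K → ℝ, MemDBSC g ∧ (∀ x ∈ osSet f ε n, g x = 0) ∧
      ∀ x ∉ osSet f ε n, |f x - g x| < ε := by
  induction n with
  | zero => exact ⟨0, .zero, fun _ _ => rfl, fun x hx => absurd (mem_univ x) hx⟩
  | succ n ih =>
    obtain ⟨g, hg, hg0, hgf⟩ := ih
    have ⟨C, hC⟩ := hf
    obtain ⟨φ, hφ, hφf⟩ := exists_continuousOn_compl_osSet hC ε n
    have hU := (isClosed_osSet hf ε (n + 1)).isOpen_compl
    have hV := (isClosed_osSet hf ε n).isOpen_compl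
    have hVU : (osSet f ε n)ᶜ ⊆ (osSet f ε (n + 1))ᶜ :=
      compl_subset_compl.2 (osSet_succ_subset f ε n)
    refine ⟨g + ((osSet f ε (n + 1))ᶜ.indicator φ + -(osSet f ε n)ᶜ.indicator φ),
      hg.add ((memDBSC_indicator hU hφ fun x hx => (hφf x hx).1).add
        (memDBSC_indicator hV (hφ.mono hVU) fun x hx => (hφf x (hVU hx)).1).neg), ?_, ?_⟩
    · intro x hx
      have hx' := osSet_succ_subset f ε n hx
      simp [hx, hx', hg0 x hx']
    · intro x hx
      by_cases hx' : x ∈ osSet f ε n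
      · simpa [hx, hx', hg0 x hx'] using (hφf x hx).2 hx'
      · simpa [hx, hx'] using hgf x hx'

lemma memBHalf_of_exists_osSet_eq_empty (hb : BddFun f)
    (h : ∀ ε > (0 : ℝ), ∃ n : ℕ, osSet f ε n = ∅) : MemBHalf f := by
  have hclose : ∀ m : ℕ, ∃ g : K → ℝ, MemDBSC g ∧ ∀ x, |f x - g x| < 1 / ((m : ℝ) + 1) := by
    intro m
    obtain ⟨n, hn⟩ := h (1 / ((m : ℝ) + 1)) Nat.one_div_pos_of_nat
    obtain ⟨g, hg, -, hgf⟩ := exists_memDBSC_close_off_osSet hb (1 / ((m : ℝ) + 1)) n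
    exact ⟨g, hg, fun x => hgf x (hn ▸ notMem_empty x)⟩
  choose g hg hgf using hclose
  refine ⟨g, hg, Metric.tendstoUniformly_iff.2 fun ε hε => ?_⟩
  filter_upwards [tendsto_one_div_add_atTop_nhds_zero_nat.eventually_lt_const hε] with m hm x
  exact (hgf m x).trans hm

end Approximation

/-- **Proposition 1.1.** `f ∈ B_{1/2}(K)` iff for every `ε > 0` some oscillation
set `os_n(f, ε)` is empty. -/
theorem memBHalf_iff_osSet_empty {K : Type*} [MetricSpace K]
    [TopologicalSpace.SeparableSpace K] (f : K → ℝ) (hb : BddFun f) :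
    MemBHalf f ↔ ∀ ε > (0 : ℝ), ∃ n : ℕ, osSet f ε n = ∅ :=
  ⟨fun h _ hε => exists_osSet_eq_empty_of_memBHalf hb h hε, memBHalf_of_exists_osSet_eq_empty hb⟩
end
end

section
/- Let K be a separable metric space and let f : K → ℝ be a bounded non-negative lower semicontinuous function. Then f ∈ DBSC(K) and ‖f‖_D = ‖f‖_∞. Consequently, if f : K → ℝ is bounded and upper semicontinuous or lower semicontinuous (not necessarily non-negative), then ‖f‖_D ≤ 3‖f‖_∞. -/
open Filter Topology Set

noncomputable section

open scoped ENNReal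

/-- The Lipschitz regularization `x ↦ inf_y (f y + n * dist x y)` of `f`. -/
def lipReg {K : Type*} [MetricSpace K] (f : K → ℝ) (n : ℕ) (x : K) : ℝ :=
  ⨅ y, (f y + n * dist x y)

section LipReg

variable {K : Type*} [MetricSpace K] {f : K → ℝ} {M : ℝ}

lemma bddBelow_range_lipReg (hM : ∀ x, |f x| ≤ M) (n : ℕ) (x : K) :
    BddBelow (range fun y => f y + n * dist x y) := by
  refine ⟨-M, ?_⟩
  rintro _ ⟨y, rfl⟩
  have h1 := (abs_le.1 (hM y)).1
  have h2 : 0 ≤ (n : ℝ) * dist x y := by positivity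
  simp only
  linarith

lemma lipReg_le (hM : ∀ x, |f x| ≤ M) (n : ℕ) (x : K) : lipReg f n x ≤ f x := by
  simpa [lipReg] using ciInf_le (bddBelow_range_lipReg hM n x) x

lemma lipReg_mono (hM : ∀ x, |f x| ≤ M) (x : K) : Monotone fun n => lipReg f n x := by
  intro m n hmn
  refine ciInf_mono (bddBelow_range_lipReg hM m x) fun y => ?_
  gcongr

lemma continuous_lipReg (hM : ∀ x, |f x| ≤ M) (n : ℕ) : Continuous (lipReg f n) := by
  refine (LipschitzWith.of_le_add_mul (n : NNReal) fun x y => ?_).continuous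
  have : Nonempty K := ⟨x⟩
  rw [← sub_le_iff_le_add]
  refine le_ciInf fun z => ?_
  have h1 := ciInf_le (bddBelow_range_lipReg hM n x) z
  have h2 : (n : ℝ) * dist x z ≤ n * (dist x y + dist y z) := by
    gcongr
    exact dist_triangle x y z
  simp only [lipReg, NNReal.coe_natCast] at h1 ⊢
  linarith

lemma tendsto_lipReg (hM : ∀ x, |f x| ≤ M) (hf : LowerSemicontinuous f) (x : K) :
    Tendsto (fun n => lipReg f n x) atTop (𝓝 (f x)) := by
  have : Nonempty K := ⟨x⟩
  refine tendsto_order.2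
    ⟨fun a ha => ?_, fun b hb => Eventually.of_forall fun n => (lipReg_le hM n x).trans_lt hb⟩
  obtain ⟨a', haa', ha'⟩ := exists_between ha
  obtain ⟨δ, hδ, hball⟩ := Metric.eventually_nhds_iff.1 (hf x a' ha')
  obtain ⟨N, hN⟩ := exists_nat_gt ((a' + M) / δ)
  rw [div_lt_iff₀ hδ] at hN
  filter_upwards [eventually_ge_atTop N] with n hn
  refine haa'.trans_le (le_ciInf fun y => ?_)
  rcases lt_or_ge (dist y x) δ with h | h
  · have h1 := hball h
    have h2 : 0 ≤ (n : ℝ) * dist x y := by positivity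
    linarith
  · have h1 := (abs_le.1 (hM y)).1
    have h2 : (N : ℝ) * δ ≤ n * dist x y := by
      rw [dist_comm x y]
      gcongr
    linarith

/-- A bounded lower semicontinuous function is the sum of a series of continuous functions which,
apart from the constant initial term `⨅ y, f y`, are nonnegative. -/
lemma LowerSemicontinuous.exists_series (hf : LowerSemicontinuous f) (hM : ∀ x, |f x| ≤ M) :
    ∃ φ : ℕ → K → ℝ, (∀ j, Continuous (φ j)) ∧ (∀ x, HasSum (fun j => φ j x) (f x)) ∧
      ∀ x, HasSum (fun j => |φ j x|) (|⨅ y, f y| + (f x - ⨅ y, f y)) := by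
  have hzero : ∀ x, lipReg f 0 x = ⨅ y, f y := fun x => by simp [lipReg]
  have htail : ∀ x, HasSum (fun j => lipReg f (j + 1) x - lipReg f j x) (f x - ⨅ y, f y) := by
    intro x
    rw [hasSum_iff_tendsto_nat_of_nonneg
      fun j => sub_nonneg.2 (lipReg_mono hM x (Nat.le_succ j))]
    simp_rw [Finset.sum_range_sub (fun j => lipReg f j x), hzero]
    exact (tendsto_lipReg hM hf x).sub_const _
  refine ⟨fun j => Nat.casesOn j (lipReg f 0) fun i x => lipReg f (i + 1) x - lipReg f i x,
    ?_, fun x => ?_, fun x => ?_⟩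
  · rintro (_ | j)
    · exact continuous_lipReg hM 0
    · exact (continuous_lipReg hM (j + 1)).sub (continuous_lipReg hM j)
  · rw [← hasSum_nat_add_iff' 1]
    simpa [hzero] using htail x
  · rw [← hasSum_nat_add_iff' 1]
    have habs : ∀ j, |lipReg f (j + 1) x - lipReg f j x| = lipReg f (j + 1) x - lipReg f j x :=
      fun j => abs_of_nonneg (sub_nonneg.2 (lipReg_mono hM x (Nat.le_succ j)))
    simpa [hzero, habs] using htail x

end LipReg

lemma DNorm_of_isEmpty {X : Type*} [TopologicalSpace X] [IsEmpty X] (f : X → ℝ) :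
    DNorm f = 0 := by
  have : {c : ℝ | ∃ φ : ℕ → X → ℝ, (∀ j, Continuous (φ j)) ∧ (∀ x, Summable fun j => |φ j x|) ∧
      (∀ x, ∑' j, φ j x = f x) ∧ (∀ x, ∑' j, |φ j x| ≤ c)} = univ :=
    eq_univ_of_forall fun c => ⟨fun _ _ => 0, fun _ => continuous_const, isEmptyElim,
      isEmptyElim, isEmptyElim⟩
  rw [DNorm, this, Real.sInf_univ]

lemma supNorm_le_of_series {X : Type*} [Nonempty X] {f : X → ℝ} {c : ℝ} {φ : ℕ → X → ℝ}
    (hs : ∀ x, Summable fun j => |φ j x|)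
    (hφ : ∀ x, ∑' j, φ j x = f x) (hc : ∀ x, ∑' j, |φ j x| ≤ c) : supNorm f ≤ c :=
  ciSup_le fun x => by
    have h := norm_tsum_le_tsum_norm (f := fun j => φ j x) (by simpa using hs x)
    simp only [Real.norm_eq_abs, hφ x] at h
    exact h.trans (hc x)

section DNorm

variable {X : Type*} [TopologicalSpace X] [Nonempty X] {f : X → ℝ} {c : ℝ} {φ : ℕ → X → ℝ}

lemma DNorm_le_of_series (hcont : ∀ j, Continuous (φ j)) (hs : ∀ x, Summable fun j => |φ j x|)
    (hφ : ∀ x, ∑' j, φ j x = f x) (hc : ∀ x, ∑' j, |φ j x| ≤ c) : DNorm f ≤ c :=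
  csInf_le ⟨supNorm f, by
    rintro _ ⟨ψ, -, hs, hψ, hc⟩
    exact supNorm_le_of_series hs hψ hc⟩ ⟨φ, hcont, hs, hφ, hc⟩

lemma supNorm_le_DNorm_of_series (hcont : ∀ j, Continuous (φ j))
    (hs : ∀ x, Summable fun j => |φ j x|)
    (hφ : ∀ x, ∑' j, φ j x = f x) (hc : ∀ x, ∑' j, |φ j x| ≤ c) : supNorm f ≤ DNorm f := by
  refine le_csInf ⟨c, φ, hcont, hs, hφ, hc⟩ ?_
  rintro _ ⟨ψ, -, hs, hψ, hc⟩
  exact supNorm_le_of_series hs hψ hc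

end DNorm

lemma BddFun.abs_le_supNorm {X : Type*} {f : X → ℝ} (hf : BddFun f) (x : X) :
    |f x| ≤ supNorm f := by
  obtain ⟨C, hC⟩ := hf
  exact le_ciSup (f := fun x => |f x|) ⟨C, forall_mem_range.2 hC⟩ x

lemma DNorm_neg {X : Type*} [TopologicalSpace X] (f : X → ℝ) : DNorm (-f) = DNorm f := by
  unfold DNorm
  congr 1
  ext c
  constructor
  all_goals
    rintro ⟨φ, h1, h2, h3, h4⟩
    refine ⟨fun j x => -φ j x, fun j => (h1 j).neg, by simpa using h2, fun x => ?_,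
      by simpa using h4⟩
    simp [tsum_neg, h3]

lemma supNorm_neg {X : Type*} (f : X → ℝ) : supNorm (-f) = supNorm f := by
  simp [supNorm]

lemma LowerSemicontinuous.DNorm_eq_supNorm_of_nonneg {K : Type*} [MetricSpace K] {f : K → ℝ}
    (hf : LowerSemicontinuous f) (hb : BddFun f) (h0 : ∀ x, 0 ≤ f x) :
    DNorm f = supNorm f := by
  cases isEmpty_or_nonempty K
  · rw [DNorm_of_isEmpty, supNorm, Real.iSup_of_isEmpty]
  obtain ⟨φ, hcont, hφ, habs⟩ := hf.exists_series hb.abs_le_supNorm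
  have hc : ∀ x, ∑' j, |φ j x| ≤ supNorm f := fun x => by
    rw [(habs x).tsum_eq, abs_of_nonneg (le_ciInf h0), add_sub_cancel]
    exact (le_abs_self _).trans (hb.abs_le_supNorm x)
  exact le_antisymm
    (DNorm_le_of_series hcont (fun x => (habs x).summable) (fun x => (hφ x).tsum_eq) hc)
    (supNorm_le_DNorm_of_series hcont (fun x => (habs x).summable) (fun x => (hφ x).tsum_eq) hc)

lemma LowerSemicontinuous.DNorm_le_three_mul_supNorm {K : Type*} [MetricSpace K] {f : K → ℝ}
    (hf : LowerSemicontinuous f) (hb : BddFun f) : DNorm f ≤ 3 * supNorm f := by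
  cases isEmpty_or_nonempty K
  · rw [DNorm_of_isEmpty, supNorm, Real.iSup_of_isEmpty, mul_zero]
  obtain ⟨φ, hcont, hφ, habs⟩ := hf.exists_series hb.abs_le_supNorm
  refine DNorm_le_of_series hcont (fun x => (habs x).summable) (fun x => (hφ x).tsum_eq) fun x => ?_
  rw [(habs x).tsum_eq]
  have hlow : -supNorm f ≤ ⨅ y, f y := le_ciInf fun y => (abs_le.1 (hb.abs_le_supNorm y)).1
  have hinf : ⨅ y, f y ≤ f x :=
    ciInf_le ⟨-supNorm f, forall_mem_range.2 fun y => (abs_le.1 (hb.abs_le_supNorm y)).1⟩ x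
  have hup : f x ≤ supNorm f := (abs_le.1 (hb.abs_le_supNorm x)).2
  have hm : |⨅ y, f y| ≤ supNorm f := abs_le.2 ⟨hlow, hinf.trans hup⟩
  linarith

/-- **Lemma 2.1.** A bounded non-negative lower semicontinuous function is a
D-function with `‖f‖_D = ‖f‖_∞`; hence any bounded semicontinuous function
satisfies `‖f‖_D ≤ 3 ‖f‖_∞`. -/
theorem dnorm_of_semicontinuous {K : Type*} [MetricSpace K]
    [TopologicalSpace.SeparableSpace K] :
    (∀ f : K → ℝ, BddFun f → (∀ x, 0 ≤ f x) → LowerSemicontinuous f →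
      MemDBSC f ∧ DNorm f = supNorm f) ∧
    (∀ f : K → ℝ, BddFun f →
      (UpperSemicontinuous f ∨ LowerSemicontinuous f) →
      DNorm f ≤ 3 * supNorm f) := by
  refine ⟨fun f hb h0 hf => ⟨?_, hf.DNorm_eq_supNorm_of_nonneg hb h0⟩, fun f hb hf => ?_⟩
  · exact ⟨f, 0, hb, ⟨0, by simp⟩, hf, lowerSemicontinuous_const, (sub_zero f).symm⟩
  · rcases hf with hf | hf
    · obtain ⟨C, hC⟩ := hb
      rw [← DNorm_neg, ← supNorm_neg]
      exact LowerSemicontinuous.DNorm_le_three_mul_supNorm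
        (fun x y hy => (hf x (-y) (lt_neg_of_lt_neg hy)).mono fun _ => lt_neg_of_lt_neg)
        ⟨C, by simpa using hC⟩
    · exact hf.DNorm_le_three_mul_supNorm hb
end
end

section
/- Let K be a separable metric space and let f : K → ℝ be a simple function (taking only finitely many values). The following are equivalent: (1) f ∈ B_{1/2}(K); (2) f has finite Baire index; (3) f ∈ DBSC(K); (4) there exist pairwise disjoint sets W_1, …, W_m, each a difference of two closed subsets of K, and scalars c_1, …, c_m with f = Σ_{i=1}^m c_i·χ_{W_i}. -/
open Filter Topology Set

noncomputable section

open scoped ENNReal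

/-- The varying sets of `f`: at each step, discard the points near which the restriction of `f`
is constant. -/
def varyingSet {X : Type*} [TopologicalSpace X] (f : X → ℝ) : ℕ → Set X
  | 0 => Set.univ
  | n + 1 => {x | x ∈ varyingSet f n ∧ ∀ c, ¬ ∀ᶠ y in 𝓝 x, y ∈ varyingSet f n → f y = c}

/-- The part of the `n`-th varying set near which the restriction of `f` is constantly `c`. -/
def constantPiece {X : Type*} [TopologicalSpace X] (f : X → ℝ) (n : ℕ) (c : ℝ) : Set X :=
  {x | x ∈ varyingSet f n ∧ ∀ᶠ y in 𝓝 x, y ∈ varyingSet f n → f y = c}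

section Oscillation

variable {X : Type*} [TopologicalSpace X]

lemma losc_nonneg (f : X → ℝ) (x : X) : 0 ≤ losc f x := by
  refine Real.sInf_nonneg ?_
  rintro _ ⟨V, -, -, rfl⟩
  refine Real.sSup_nonneg ?_
  rintro _ ⟨y, -, rfl⟩
  exact abs_nonneg _

lemma losc_le_sSup (f : X → ℝ) {x : X} {V : Set X} (hV : IsOpen V) (hx : x ∈ V) :
    losc f x ≤ sSup ((fun y => |f y - f x|) '' V) := by
  refine csInf_le ⟨0, ?_⟩ ⟨V, hV, hx, rfl⟩
  rintro _ ⟨V, -, -, rfl⟩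
  refine Real.sSup_nonneg ?_
  rintro _ ⟨y, -, rfl⟩
  exact abs_nonneg _

lemma osc_le_sSup (f : X → ℝ) {x : X} {V : Set X} (hV : IsOpen V) (hx : x ∈ V) :
    osc f x ≤ sSup (losc f '' V) := by
  refine csInf_le ⟨0, ?_⟩ ⟨V, hV, hx, rfl⟩
  rintro _ ⟨V, -, -, rfl⟩
  refine Real.sSup_nonneg ?_
  rintro _ ⟨y, -, rfl⟩
  exact losc_nonneg f y

lemma osc_nonpos_of_eqOn_const {f : X → ℝ} {x : X} {V : Set X} {c : ℝ} (hV : IsOpen V)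
    (hx : x ∈ V) (hc : ∀ y ∈ V, f y = c) : osc f x ≤ 0 := by
  refine (osc_le_sSup f hV hx).trans (Real.sSup_nonpos ?_)
  rintro _ ⟨y, hy, rfl⟩
  refine (losc_le_sSup f hV hy).trans (Real.sSup_nonpos ?_)
  rintro _ ⟨z, hz, rfl⟩
  simp [hc y hy, hc z hz]

lemma losc_le_of_bound {f : X → ℝ} {C : ℝ} (hC : ∀ x, |f x| ≤ C) (x : X) :
    losc f x ≤ 2 * C := by
  refine (losc_le_sSup f isOpen_univ (mem_univ x)).trans
    (csSup_le ⟨_, x, mem_univ x, rfl⟩ ?_)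
  rintro _ ⟨y, -, rfl⟩
  have := abs_sub (f y) (f x)
  linarith [hC x, hC y]

lemma exists_forall_abs_sub_lt_of_osc_lt {f : X → ℝ} (hf : BddFun f) {x : X} {ε : ℝ}
    (h : osc f x < ε) : ∃ V : Set X, IsOpen V ∧ x ∈ V ∧ ∀ y ∈ V, |f y - f x| < ε := by
  obtain ⟨C, hC⟩ := hf
  obtain ⟨_, ⟨V, hV, hxV, rfl⟩, hlt⟩ :=
    exists_lt_of_csInf_lt (by exact ⟨_, univ, isOpen_univ, mem_univ x, rfl⟩) h
  have hlosc : losc f x < ε := by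
    refine (le_csSup ⟨2 * C, ?_⟩ (mem_image_of_mem _ hxV)).trans_lt hlt
    rintro _ ⟨y, -, rfl⟩
    exact losc_le_of_bound hC y
  obtain ⟨_, ⟨V', hV', hxV', rfl⟩, hlt'⟩ :=
    exists_lt_of_csInf_lt (by exact ⟨_, univ, isOpen_univ, mem_univ x, rfl⟩) hlosc
  refine ⟨V', hV', hxV', fun y hy => ?_⟩
  refine (le_csSup ⟨2 * C, ?_⟩ (mem_image_of_mem (fun y => |f y - f x|) hy)).trans_lt hlt'
  rintro _ ⟨z, -, rfl⟩
  have := abs_sub (f z) (f x)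
  linarith [hC x, hC z]

lemma osSet_subset_varyingSet (f : X → ℝ) {ε : ℝ} (hε : 0 < ε) (n : ℕ) :
    osSet f ε n ⊆ varyingSet f n := by
  induction n with
  | zero => exact subset_rfl
  | succ n ih =>
    rintro x ⟨hx, hosc⟩
    refine ⟨ih hx, fun c hc => ?_⟩
    obtain ⟨V, hV, hVo, hxV⟩ := eventually_nhds_iff.mp hc
    have := osc_nonpos_of_eqOn_const (f := (osSet f ε n).domRestrict f) (x := ⟨x, hx⟩) (c := c)
      (hVo.preimage continuous_subtype_val) hxV (fun y hy => hV y hy (ih y.2))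
    exact (hε.trans_le hosc).not_ge this

lemma varyingSet_subset_osSet {f : X → ℝ} (hf : BddFun f) {δ : ℝ}
    (hδ : ∀ x y, |f y - f x| < δ → f y = f x) (n : ℕ) :
    varyingSet f n ⊆ osSet f δ n := by
  induction n with
  | zero => exact subset_rfl
  | succ n ih =>
    rintro x ⟨hx, hne⟩
    refine ⟨ih hx, le_of_not_gt fun hlt => hne (f x) ?_⟩
    obtain ⟨C, hC⟩ := hf
    obtain ⟨V, hV, hxV, hVx⟩ := exists_forall_abs_sub_lt_of_osc_lt
      (f := (osSet f δ n).domRestrict f) ⟨C, fun y => hC y⟩ hlt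
    obtain ⟨U, hU, rfl⟩ := isOpen_induced_iff.mp hV
    filter_upwards [hU.mem_nhds hxV] with y hyU hy
    exact hδ x y (hVx ⟨y, ih hy⟩ hyU)

lemma isClosed_varyingSet (f : X → ℝ) (n : ℕ) : IsClosed (varyingSet f n) := by
  induction n with
  | zero => exact isClosed_univ
  | succ n ih =>
    refine ih.inter (s₂ := {x | ∀ c, ¬ ∀ᶠ y in 𝓝 x, y ∈ varyingSet f n → f y = c}) ?_
    simp only [ofPred_forall]
    exact isClosed_iInter fun c => isOpen_setOfPred_eventually_nhds.isClosed_compl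

lemma varyingSet_antitone (f : X → ℝ) : Antitone (varyingSet f) :=
  antitone_nat_of_succ_le fun _ _ hx => hx.1

lemma eq_of_mem_constantPiece {f : X → ℝ} {n : ℕ} {c : ℝ} {x : X}
    (hx : x ∈ constantPiece f n c) : f x = c :=
  hx.2.self_of_nhds hx.1

lemma notMem_varyingSet_succ {f : X → ℝ} {n : ℕ} {c : ℝ} {x : X}
    (hx : x ∈ constantPiece f n c) : x ∉ varyingSet f (n + 1) :=
  fun h => h.2 c hx.2

lemma eq_of_mem_constantPiece_of_mem {f : X → ℝ} {m n : ℕ} {c d : ℝ} {x : X}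
    (hm : x ∈ constantPiece f m c) (hn : x ∈ constantPiece f n d) : m = n ∧ c = d := by
  refine ⟨?_, (eq_of_mem_constantPiece hm).symm.trans (eq_of_mem_constantPiece hn)⟩
  rcases lt_trichotomy m n with h | h | h
  · exact absurd (varyingSet_antitone f (Nat.succ_le_of_lt h) hn.1) (notMem_varyingSet_succ hm)
  · exact h
  · exact absurd (varyingSet_antitone f (Nat.succ_le_of_lt h) hm.1) (notMem_varyingSet_succ hn)

lemma exists_mem_constantPiece {f : X → ℝ} {n : ℕ} (hn : varyingSet f n = ∅) (x : X) :
    ∃ j < n, x ∈ constantPiece f j (f x) := by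
  classical
  have hex : ∃ k, x ∉ varyingSet f k := ⟨n, by simp [hn]⟩
  obtain ⟨k, hk⟩ : ∃ k, Nat.find hex = k + 1 :=
    Nat.exists_eq_succ_of_ne_zero fun h0 => by
      have := Nat.find_spec hex
      rw [h0] at this
      exact this (mem_univ x)
  have hkx : x ∈ varyingSet f k := not_not.mp (Nat.find_min hex (by omega))
  have hk1 : x ∉ varyingSet f (k + 1) := hk ▸ Nat.find_spec hex
  have hkn : Nat.find hex ≤ n := Nat.find_min' hex (by simp [hn])
  refine ⟨k, by omega, hkx, ?_⟩
  have : ∃ c, ∀ᶠ y in 𝓝 x, y ∈ varyingSet f k → f y = c := by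
    by_contra h
    exact hk1 ⟨hkx, not_exists.mp h⟩
  obtain ⟨c, hc⟩ := this
  have hfc : f x = c := hc.self_of_nhds hkx
  rwa [hfc]

lemma exists_isClosed_constantPiece_eq_diff (f : X → ℝ) (n : ℕ) (c : ℝ) :
    ∃ A B : Set X, IsClosed A ∧ IsClosed B ∧ constantPiece f n c = A \ B := by
  refine ⟨varyingSet f n, {x | ∀ᶠ y in 𝓝 x, y ∈ varyingSet f n → f y = c}ᶜ,
    isClosed_varyingSet f n, isOpen_setOfPred_eventually_nhds.isClosed_compl, ?_⟩
  rw [sdiff_compl]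
  rfl

lemma exists_disjoint_diff_decomposition {f : X → ℝ} (hs : (range f).Finite) {n : ℕ}
    (hn : varyingSet f n = ∅) :
    ∃ (m : ℕ) (W : Fin m → Set X) (c : Fin m → ℝ),
      (∀ i, ∃ A B : Set X, IsClosed A ∧ IsClosed B ∧ W i = A \ B) ∧
      (Pairwise fun i j => Disjoint (W i) (W j)) ∧
      f = fun x => ∑ i, c i * (W i).indicator (fun _ => (1 : ℝ)) x := by
  have := hs.fintype
  let e := (Fintype.equivFin (Fin n × range f)).symm
  have hdisj : Pairwise fun i j =>
      Disjoint (constantPiece f (e i).1 (e i).2) (constantPiece f (e j).1 (e j).2) := by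
    refine fun i j hij => disjoint_left.mpr fun x hi hj => hij (e.injective ?_)
    obtain ⟨h1, h2⟩ := eq_of_mem_constantPiece_of_mem hi hj
    exact Prod.ext (Fin.ext h1) (Subtype.ext h2)
  refine ⟨_, fun i => constantPiece f (e i).1 (e i).2, fun i => (e i).2,
    fun i => exists_isClosed_constantPiece_eq_diff _ _ _, hdisj, ?_⟩
  funext x
  obtain ⟨j, hj, hx⟩ := exists_mem_constantPiece hn x
  obtain ⟨i, hi⟩ := e.surjective (⟨j, hj⟩, ⟨f x, mem_range_self x⟩)
  have hxi : x ∈ constantPiece f (e i).1 (e i).2 := by rw [hi]; exact hx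
  rw [Finset.sum_eq_single i]
  · rw [indicator_of_mem hxi, mul_one]
    exact eq_of_mem_constantPiece hxi
  · intro k _ hk
    rw [indicator_of_notMem (disjoint_left.mp (hdisj hk.symm) hxi), mul_zero]
  · simp

/-- Each derivation step allows an increase of `u + v` by a fixed amount. -/
lemma exists_add_le_of_mem_varyingSet {f u v : X → ℝ} (hu : LowerSemicontinuous u)
    (hv : LowerSemicontinuous v) {η : ℝ} (hη : 0 < η)
    (h : ∀ x y, f y ≠ f x → 4 * η ≤ |(u y - v y) - (u x - v x)|) (n : ℕ) :
    ∀ x ∈ varyingSet f n, ∃ y, u x + v x + n * (2 * η) ≤ u y + v y := by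
  induction n with
  | zero => exact fun x _ => ⟨x, by simp⟩
  | succ n ih =>
    rintro x ⟨-, hx⟩
    have hfr := (not_eventually.mp (hx (f x))).and_eventually
      ((hu x (u x - η) (by linarith)).and (hv x (v x - η) (by linarith)))
    obtain ⟨y, hy, huy, hvy⟩ := hfr.exists
    obtain ⟨hyn, hne⟩ := Classical.not_imp.mp hy
    obtain ⟨z, hz⟩ := ih y hyn
    refine ⟨z, ?_⟩
    push_cast
    rcases le_abs.mp (h x y hne) with h' | h' <;> linarith

lemma exists_varyingSet_eq_empty_of_memBHalf {f : X → ℝ} {δ : ℝ} (hδ : 0 < δ)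
    (hgap : ∀ x y, |f y - f x| < δ → f y = f x) (hf : MemBHalf f) :
    ∃ n, varyingSet f n = ∅ := by
  obtain ⟨g, hg, hlim⟩ := hf
  obtain ⟨N, hN⟩ := (Metric.tendstoUniformly_iff.mp hlim (δ / 4) (by linarith)).exists
  obtain ⟨u, v, ⟨C, hC⟩, ⟨D, hD⟩, hu, hv, huv⟩ := hg N
  have hsep : ∀ x y, f y ≠ f x → 4 * (δ / 8) ≤ |(u y - v y) - (u x - v x)| := by
    intro x y hne
    have h1 : δ ≤ |f y - f x| := le_of_not_gt fun hlt => hne (hgap x y hlt)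
    have hx := hN x
    have hy := hN y
    simp only [huv, Pi.sub_apply, Real.dist_eq] at hx hy
    rw [abs_lt] at hx hy
    rw [le_abs] at h1 ⊢
    rcases h1 with h1 | h1
    · left; linarith
    · right; linarith
  obtain ⟨n, hn⟩ := exists_nat_gt ((2 * C + 2 * D) / (2 * (δ / 8)))
  rw [div_lt_iff₀ (by linarith)] at hn
  refine ⟨n, eq_empty_of_forall_notMem fun x hx => ?_⟩
  obtain ⟨y, hy⟩ := exists_add_le_of_mem_varyingSet hu hv (by linarith) hsep n x hx
  linarith [abs_le.mp (hC x), abs_le.mp (hC y), abs_le.mp (hD x), abs_le.mp (hD y)]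

end Oscillation

section DBSC

variable {X : Type*} [TopologicalSpace X]

lemma memDBSC_const_mul_indicator {A : Set X} (hA : IsClosed A) (c : ℝ) :
    MemDBSC fun x => c * A.indicator (fun _ => (1 : ℝ)) x := by
  have key : ∀ d : ℝ, d ≤ 0 → MemDBSC fun x => d * A.indicator (fun _ => (1 : ℝ)) x := by
    intro d hd
    have heq : (fun x => d * A.indicator (fun _ => (1 : ℝ)) x) = A.indicator fun _ => d := by
      funext x
      by_cases hx : x ∈ A <;> simp [hx]
    rw [heq]
    refine ⟨A.indicator fun _ => d, 0, ⟨|d|, fun x => ?_⟩, ⟨0, by simp⟩,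
      hA.lowerSemicontinuous_indicator hd, lowerSemicontinuous_const, by simp⟩
    by_cases hx : x ∈ A <;> simp [hx]
  rcases le_total c 0 with hc | hc
  · exact key c hc
  · convert (key (-c) (by linarith)).neg using 1
    funext x
    simp

lemma memDBSC_const_mul_indicator_diff {A B : Set X} (hA : IsClosed A) (hB : IsClosed B)
    (c : ℝ) : MemDBSC fun x => c * (A \ B).indicator (fun _ => (1 : ℝ)) x := by
  convert (memDBSC_const_mul_indicator hA c).add
    (memDBSC_const_mul_indicator (hA.inter hB) c).neg using 1
  funext x
  by_cases hxA : x ∈ A <;> by_cases hxB : x ∈ B <;> simp [hxA, hxB]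

lemma memDBSC_sum {ι : Type*} (s : Finset ι) {f : ι → X → ℝ} (hf : ∀ i, MemDBSC (f i)) :
    MemDBSC (∑ i ∈ s, f i) := by
  refine Finset.sum_induction f MemDBSC (fun _ _ => MemDBSC.add) ?_ fun i _ => hf i
  exact ⟨0, 0, ⟨0, by simp⟩, ⟨0, by simp⟩, lowerSemicontinuous_const,
    lowerSemicontinuous_const, by simp⟩

end DBSC

lemma bddFun_of_finite_range {X : Type*} {f : X → ℝ} (hs : (range f).Finite) : BddFun f := by
  obtain ⟨C, hC⟩ := hs.isBounded.exists_norm_le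
  exact ⟨C, fun x => hC _ (mem_range_self x)⟩

lemma exists_pos_gap_of_finite_range {X : Type*} {f : X → ℝ} (hs : (range f).Finite) :
    ∃ δ > 0, ∀ x y, |f y - f x| < δ → f y = f x := by
  obtain ⟨δ, hδ, h⟩ : ∃ δ > 0, ∀ d ∈ (fun p : ℝ × ℝ => |p.2 - p.1|) '' (range f ×ˢ range f),
      d < δ → d ≤ 0 := by
    have hfin := (hs.prod hs).image fun p : ℝ × ℝ => |p.2 - p.1|
    have hev : ∀ᶠ δ in 𝓝[>] (0 : ℝ),
        ∀ d ∈ (fun p : ℝ × ℝ => |p.2 - p.1|) '' (range f ×ˢ range f), d < δ → d ≤ 0 := by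
      rw [hfin.eventually_all]
      intro d _
      rcases le_or_gt d 0 with hd | hd
      · exact Eventually.of_forall fun _ _ => hd
      · filter_upwards [Ioo_mem_nhdsGT hd] with δ hδ hlt
        exact absurd hlt (not_lt.mpr hδ.2.le)
    obtain ⟨δ, h, hδ⟩ := (hev.and self_mem_nhdsWithin).exists
    exact ⟨δ, hδ, h⟩
  refine ⟨δ, hδ, fun x y hxy => sub_eq_zero.mp (abs_nonpos_iff.mp (h _ ?_ hxy))⟩
  exact ⟨(f x, f y), ⟨mem_range_self x, mem_range_self y⟩, rfl⟩

/-- **Proposition 2.2.** For a simple function `f`, membership in `B_{1/2}(K)`,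
finiteness of the Baire index, membership in `DBSC(K)`, and being a linear
combination of indicators of disjoint differences of closed sets are equivalent. -/
theorem simple_function_tfae {K : Type*} [MetricSpace K]
    [TopologicalSpace.SeparableSpace K] (f : K → ℝ) (hs : (Set.range f).Finite) :
    List.TFAE [MemBHalf f, FiniteBaireIndex f, MemDBSC f,
      ∃ (m : ℕ) (W : Fin m → Set K) (c : Fin m → ℝ),
        (∀ i, ∃ A B : Set K, IsClosed A ∧ IsClosed B ∧ W i = A \ B) ∧
        (Pairwise fun i j => Disjoint (W i) (W j)) ∧
        f = fun x => ∑ i, c i * (W i).indicator (fun _ => (1 : ℝ)) x] := by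
  obtain ⟨δ, hδ, hgap⟩ := exists_pos_gap_of_finite_range hs
  tfae_have 1 → 2 := fun h => by
    obtain ⟨n, hn⟩ := exists_varyingSet_eq_empty_of_memBHalf hδ hgap h
    exact ⟨n, fun ε hε => subset_empty_iff.mp (hn ▸ osSet_subset_varyingSet f hε n)⟩
  tfae_have 2 → 4 := fun ⟨n, hn⟩ =>
    exists_disjoint_diff_decomposition hs (subset_empty_iff.mp
      (hn δ hδ ▸ varyingSet_subset_osSet (bddFun_of_finite_range hs) hgap n))
  tfae_have 4 → 3 := by
    rintro ⟨m, W, c, hW, -, rfl⟩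
    convert memDBSC_sum Finset.univ
      (f := fun i x => c i * (W i).indicator (fun _ => (1 : ℝ)) x) (fun i => ?_) using 1
    · funext x
      simp
    · obtain ⟨A, B, hA, hB, hAB⟩ := hW i
      rw [hAB]
      exact memDBSC_const_mul_indicator_diff hA hB (c i)
  tfae_have 3 → 1 := fun h => ⟨fun _ => f, fun _ => h,
    Metric.tendstoUniformly_iff.mpr fun ε hε => Eventually.of_forall fun _ x => by simpa using hε⟩
  tfae_finish
end
end

section
/- Let K be a separable metric space, U a non-empty open subset of K, and f : K → ℝ a bounded function which vanishes off U and whose restriction to U is continuous. Then f ∈ SD(K) and ‖f‖_D = ‖f‖_∞. -/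
open Filter Topology Set

noncomputable section

open scoped ENNReal

section SupportedContinuous

variable {X : Type*}

/-- The absolute value of `f` is bounded by any constant bounding an absolutely convergent series
with sum `f`. -/
theorem abs_le_of_tsum_eq {f : X → ℝ} {C : ℝ} {φ : ℕ → X → ℝ}
    (hφ : ∀ x, Summable fun j => |φ j x|)
    (hf : ∀ x, ∑' j, φ j x = f x) (hC : ∀ x, ∑' j, |φ j x| ≤ C) (x : X) : |f x| ≤ C := by
  rw [← hf x]
  refine le_trans ?_ (hC x)
  simpa only [Real.norm_eq_abs] using norm_tsum_le_tsum_norm (f := fun j => φ j x) (hφ x)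

theorem finite_range_mul_floor_div {f : X → ℝ} {C : ℝ} (hC : ∀ x, |f x| ≤ C) {δ : ℝ}
    (hδ : 0 < δ) : (range fun x => δ * (⌊f x / δ⌋ : ℝ)).Finite := by
  refine ((finite_Icc ⌊-C / δ⌋ ⌊C / δ⌋).image fun n : ℤ => δ * (n : ℝ)).subset ?_
  rintro _ ⟨x, rfl⟩
  obtain ⟨h₁, h₂⟩ := abs_le.1 (hC x)
  exact ⟨_, ⟨Int.floor_mono (by gcongr), Int.floor_mono (by gcongr)⟩, rfl⟩

section Topological

variable [TopologicalSpace X] {U : Set X} {f g : X → ℝ} {C : ℝ}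

/-- A bounded function that is continuous on an open set `U`, multiplied by a continuous function
vanishing off `U`, is continuous. -/
theorem continuous_mul_of_continuousOn_of_eq_zero (hU : IsOpen U) (hf : ContinuousOn f U)
    (hC : ∀ x, |f x| ≤ C) (hg : Continuous g) (hg0 : ∀ x ∉ U, g x = 0) :
    Continuous fun x => f x * g x := by
  rw [continuous_iff_continuousAt]
  intro x
  by_cases hx : x ∈ U
  · exact (hf.continuousAt (hU.mem_nhds hx)).mul hg.continuousAt
  · have h0 : Tendsto (fun y => C * |g y|) (𝓝 x) (𝓝 0) := by
      have := ((hg.abs.const_mul C).continuousAt (x := x)).tendsto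
      simpa [hg0 x hx] using this
    simp only [ContinuousAt, hg0 x hx, mul_zero]
    refine squeeze_zero_norm (fun y => ?_) h0
    rw [Real.norm_eq_abs, abs_mul]
    exact mul_le_mul_of_nonneg_right (hC y) (abs_nonneg _)

/-- A nonnegative function that is continuous on an open set and vanishes off it is lower
semicontinuous. -/
theorem lowerSemicontinuous_of_continuousOn_of_eq_zero (hU : IsOpen U) (hf : ContinuousOn f U)
    (hf0 : ∀ x ∉ U, f x = 0) (hnonneg : ∀ x, 0 ≤ f x) : LowerSemicontinuous f := by
  intro x
  by_cases hx : x ∈ U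
  · exact (hf.continuousAt (hU.mem_nhds hx)).lowerSemicontinuousAt
  · intro y hy
    rw [hf0 x hx] at hy
    exact Eventually.of_forall fun z => hy.trans_le (hnonneg z)

theorem memDBSC_of_supported_continuousOn (hU : IsOpen U) (hf : ContinuousOn f U)
    (hf0 : ∀ x ∉ U, f x = 0) (hC0 : 0 ≤ C) (hC : ∀ x, |f x| ≤ C) : MemDBSC f := by
  have hind : ContinuousOn (U.indicator fun _ => C) U :=
    continuousOn_const.congr fun x hx => indicator_of_mem hx _
  have hbd : ∀ x, |U.indicator (fun _ => C) x| ≤ C := fun x => by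
    by_cases hx : x ∈ U <;> simp [hx, hC0, abs_of_nonneg]
  refine ⟨f + U.indicator fun _ => C, U.indicator fun _ => C, ⟨C + C, fun x => ?_⟩, ⟨C, hbd⟩,
    ?_, ?_, by simp⟩
  · exact (abs_add_le _ _).trans (add_le_add (hC x) (hbd x))
  · refine lowerSemicontinuous_of_continuousOn_of_eq_zero hU (hf.add hind)
      (fun x hx => by simp [hx, hf0 x hx]) fun x => ?_
    by_cases hx : x ∈ U
    · simpa [hx] using by linarith [neg_abs_le (f x), hC x]
    · simp [hx, hf0 x hx]
  · exact lowerSemicontinuous_of_continuousOn_of_eq_zero hU hind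
      (fun x hx => indicator_of_notMem hx _) fun x => indicator_nonneg (fun _ _ => hC0) x

theorem MemDBSC.sub (hf : MemDBSC f) (hg : MemDBSC g) : MemDBSC (f - g) := by
  obtain ⟨u, v, ⟨a, ha⟩, ⟨b, hb⟩, hu, hv, rfl⟩ := hf
  obtain ⟨w, z, ⟨c, hc⟩, ⟨d, hd⟩, hw, hz, rfl⟩ := hg
  exact ⟨u + z, v + w, ⟨a + d, fun x => (abs_add_le _ _).trans (add_le_add (ha x) (hd x))⟩,
    ⟨b + c, fun x => (abs_add_le _ _).trans (add_le_add (hb x) (hc x))⟩,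
    hu.add hz, hv.add hw, by abel⟩

theorem DNorm_nonneg [Nonempty X] (f : X → ℝ) : 0 ≤ DNorm f := by
  refine Real.sInf_nonneg ?_
  rintro c ⟨φ, -, hφ, hf, hc⟩
  exact (abs_nonneg _).trans (abs_le_of_tsum_eq hφ hf hc (Classical.arbitrary X))

/-- The rounding error `f - δ ⌊f / δ⌋` is continuous wherever `f` is continuous and `f / δ` is not
an integer. -/
theorem continuousAt_fract_div {δ : ℝ} {x : X} (hf : ContinuousAt f x)
    (hx : Int.fract (f x / δ) ≠ 0) : ContinuousAt (fun y => δ * Int.fract (f y / δ)) x := by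
  have h : ContinuousAt (Int.fract : ℝ → ℝ) (f x / δ) := by
    refine continuousAt_fract fun h => hx ?_
    rw [Int.fract, ← h, sub_self]
  exact continuousAt_const.mul
    (ContinuousAt.comp (f := fun y => f y / δ) h (hf.div_const δ))

theorem isOpen_fract_div_ne_zero (hU : IsOpen U) (hf : ContinuousOn f U)
    (hf0 : ∀ x ∉ U, f x = 0) (δ : ℝ) : IsOpen {x | Int.fract (f x / δ) ≠ 0} := by
  have hset : {x | Int.fract (f x / δ) ≠ 0} =
      U ∩ (fun x => f x / δ) ⁻¹' (range ((↑) : ℤ → ℝ))ᶜ := by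
    ext x
    simp only [mem_ofPred_eq, mem_inter_iff, mem_preimage, mem_compl_iff, ne_eq,
      Int.fract_eq_zero_iff]
    refine ⟨fun h => ⟨?_, h⟩, fun h => h.2⟩
    by_contra hx
    exact h ⟨0, by simp [hf0 x hx]⟩
  rw [hset]
  exact (hf.div_const δ).isOpen_inter_preimage hU
    Int.isClosedEmbedding_coe_real.isClosed_range.isOpen_compl

end Topological

section Metric

variable [MetricSpace X] {U : Set X} {f : X → ℝ} {C : ℝ}

/-- An open subset of a metric space is the set where some nonnegative continuous function is
nonzero. -/
theorem exists_continuous_pos_iff_mem (hU : IsOpen U) :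
    ∃ h : X → ℝ, Continuous h ∧ (∀ x ∈ U, 0 < h x) ∧ ∀ x ∉ U, h x = 0 := by
  rcases Uᶜ.eq_empty_or_nonempty with he | hne
  · rw [compl_empty_iff] at he
    exact ⟨fun _ => 1, continuous_const, fun _ _ => one_pos, fun x hx => by simp [he] at hx⟩
  · refine ⟨fun x => Metric.infDist x Uᶜ, Metric.continuous_infDist_pt _, fun x hx => ?_,
      fun x hx => Metric.infDist_zero_of_mem hx⟩
    exact (hU.isClosed_compl.notMem_iff_infDist_pos hne).1 fun h => h hx

theorem exists_series_of_supported_continuousOn (hU : IsOpen U) (hf : ContinuousOn f U)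
    (hf0 : ∀ x ∉ U, f x = 0) (hC : ∀ x, |f x| ≤ C) :
    ∃ φ : ℕ → X → ℝ, (∀ j, Continuous (φ j)) ∧ (∀ x, Summable fun j => |φ j x|) ∧
      (∀ x, ∑' j, φ j x = f x) ∧ (∀ x, ∑' j, |φ j x| ≤ C) := by
  obtain ⟨h, hcont, hpos, hzero⟩ := exists_continuous_pos_iff_mem hU
  have hh : ∀ x, 0 ≤ h x := fun x => by
    by_cases hx : x ∈ U
    exacts [(hpos x hx).le, (hzero x hx).ge]
  let g : ℕ → X → ℝ := fun n x => min 1 (n * h x)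
  have hgcont : ∀ n, Continuous (g n) := fun n =>
    continuous_const.min (continuous_const.mul hcont)
  have hgzero : ∀ n, ∀ x ∉ U, g n x = 0 := fun n x hx => by simp [g, hzero x hx]
  have hgmono : ∀ n x, 0 ≤ g (n + 1) x - g n x := fun n x =>
    sub_nonneg.2 (min_le_min le_rfl
      (mul_le_mul_of_nonneg_right (by exact_mod_cast n.le_succ) (hh x)))
  have hsum : ∀ x ∈ U, HasSum (fun n => g (n + 1) x - g n x) 1 := fun x hx => by
    rw [hasSum_iff_tendsto_nat_of_nonneg fun n => hgmono n x]
    simp only [Finset.sum_range_sub fun n => g n x]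
    refine tendsto_const_nhds.congr' ?_
    filter_upwards [eventually_ge_atTop ⌈1 / h x⌉₊] with n hn
    have h1 : 1 ≤ n * h x := (div_le_iff₀ (hpos x hx)).1 (Nat.ceil_le.1 hn)
    simp [g, h1]
  have hφ : ∀ x, HasSum (fun n => f x * (g (n + 1) x - g n x)) (f x) := fun x => by
    by_cases hx : x ∈ U
    · simpa using (hsum x hx).mul_left (f x)
    · simp [hf0 x hx, hasSum_zero]
  have hφabs : ∀ x, HasSum (fun n => |f x * (g (n + 1) x - g n x)|) |f x| := fun x => by
    simp only [abs_mul, abs_of_nonneg (hgmono _ x)]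
    by_cases hx : x ∈ U
    · simpa using (hsum x hx).mul_left |f x|
    · simp [hf0 x hx, hasSum_zero]
  refine ⟨fun n x => f x * (g (n + 1) x - g n x), fun n => ?_, fun x => (hφabs x).summable,
    fun x => (hφ x).tsum_eq, fun x => (hφabs x).tsum_eq.trans_le (hC x)⟩
  exact continuous_mul_of_continuousOn_of_eq_zero hU hf hC ((hgcont _).sub (hgcont _))
    fun x hx => by simp [hgzero _ x hx]

theorem DNorm_le_of_supported_continuousOn [Nonempty X] (hU : IsOpen U) (hf : ContinuousOn f U)
    (hf0 : ∀ x ∉ U, f x = 0) (hC : ∀ x, |f x| ≤ C) : DNorm f ≤ C := by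
  refine csInf_le ⟨0, ?_⟩ (exists_series_of_supported_continuousOn hU hf hf0 hC)
  rintro c ⟨φ, -, hφ, hφf, hc⟩
  exact (abs_nonneg _).trans (abs_le_of_tsum_eq hφ hφf hc (Classical.arbitrary X))

theorem DNorm_eq_supNorm_of_supported_continuousOn [Nonempty X] (hU : IsOpen U)
    (hf : ContinuousOn f U) (hf0 : ∀ x ∉ U, f x = 0) (hb : BddFun f) : DNorm f = supNorm f := by
  obtain ⟨C, hC⟩ := hb
  have hbdd : BddAbove (range fun x => |f x|) := ⟨C, forall_mem_range.2 hC⟩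
  refine le_antisymm (DNorm_le_of_supported_continuousOn hU hf hf0 (le_ciSup hbdd))
    (le_csInf ⟨C, exists_series_of_supported_continuousOn hU hf hf0 hC⟩ ?_)
  rintro c ⟨φ, -, hφ, hφf, hc⟩
  exact ciSup_le (abs_le_of_tsum_eq hφ hφf hc)

/-- Rounding `f` down to multiples of `δ` gives a simple D-function within `δ` of `f` in D-norm. -/
theorem exists_simpleD_DNorm_sub_le [Nonempty X] (hU : IsOpen U) (hf : ContinuousOn f U)
    (hf0 : ∀ x ∉ U, f x = 0) (hb : BddFun f) {δ : ℝ} (hδ : 0 < δ) :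
    ∃ φ : X → ℝ, SimpleD φ ∧ DNorm (f - φ) ≤ δ := by
  obtain ⟨C, hC⟩ := hb
  have hC0 : 0 ≤ C := (abs_nonneg _).trans (hC (Classical.arbitrary X))
  let φ : X → ℝ := fun x => δ * (⌊f x / δ⌋ : ℝ)
  have hsub : f - φ = fun x => δ * Int.fract (f x / δ) := by
    ext x
    simp only [φ, Pi.sub_apply, Int.fract]
    field_simp
  have hW := isOpen_fract_div_ne_zero hU hf hf0 δ
  have hcont : ContinuousOn (f - φ) {x | Int.fract (f x / δ) ≠ 0} := fun x hx => by
    have hxU : x ∈ U := by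
      by_contra h
      exact hx (by simp [hf0 x h])
    rw [hsub]
    exact (continuousAt_fract_div (hf.continuousAt (hU.mem_nhds hxU)) hx).continuousWithinAt
  have hzero : ∀ x ∉ {x | Int.fract (f x / δ) ≠ 0}, (f - φ) x = 0 := fun x hx => by
    simp only [mem_ofPred_eq, not_not] at hx
    rw [hsub]
    simp [hx]
  have hbound : ∀ x, |(f - φ) x| ≤ δ := fun x => by
    rw [hsub, abs_of_nonneg (mul_nonneg hδ.le (Int.fract_nonneg _))]
    exact mul_le_of_le_one_right hδ.le (Int.fract_lt_one _).le
  refine ⟨φ, ⟨?_, finite_range_mul_floor_div hC hδ⟩,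
    DNorm_le_of_supported_continuousOn hW hcont hzero hbound⟩
  rw [← sub_sub_cancel f φ]
  exact (memDBSC_of_supported_continuousOn hU hf hf0 hC0 hC).sub
    (memDBSC_of_supported_continuousOn hW hcont hzero hδ.le hbound)

end Metric

end SupportedContinuous

/-- **Lemma 2.3.** If `f` is bounded, vanishes off a non-empty open set `U`, and
is continuous on `U`, then `f ∈ SD(K)` and `‖f‖_D = ‖f‖_∞`. -/
theorem memSD_of_supported_continuous {K : Type*} [MetricSpace K]
    [TopologicalSpace.SeparableSpace K] (U : Set K) (hU : IsOpen U)
    (hne : U.Nonempty) (f : K → ℝ) (hb : BddFun f) (hsupp : ∀ x ∉ U, f x = 0)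
    (hc : Continuous (U.restrict f)) :
    MemSD f ∧ DNorm f = supNorm f := by
  have : Nonempty K := hne.to_type
  have hf : ContinuousOn f U := continuousOn_iff_continuous_domRestrict.2 hc
  refine ⟨?_, DNorm_eq_supNorm_of_supported_continuousOn hU hf hsupp hb⟩
  choose φ hφ hle using fun n : ℕ =>
    exists_simpleD_DNorm_sub_le hU hf hsupp hb (Nat.one_div_pos_of_nat (α := ℝ) (n := n))
  exact ⟨φ, hφ, squeeze_zero (fun n => DNorm_nonneg _) hle tendsto_one_div_add_atTop_nhds_zero_nat⟩
end
end

section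
/- Let K be a separable metric space, let W_1, …, W_n be closed non-empty subsets of K with K = W_1 ∪ ⋯ ∪ W_n, and let f : K → ℝ be a bounded function. Then for every x ∈ K, osc f(x) = max_{1≤i≤n} (osc(f|_{W_i}))(x)·χ_{W_i}(x), where (osc(f|_{W_i}))·χ_{W_i} denotes the oscillation of the restriction f|_{W_i}, extended by zero off W_i. -/
open Filter Topology Set

noncomputable section

open scoped ENNReal Classical

theorem uEnv_nonneg {X : Type*} [TopologicalSpace X] {g : X → ℝ} (h0 : ∀ y, 0 ≤ g y) (x : X) :
    0 ≤ uEnv g x := by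
  refine Real.sInf_nonneg ?_
  rintro _ ⟨V, -, -, rfl⟩
  refine Real.sSup_nonneg ?_
  rintro _ ⟨y, -, rfl⟩
  exact h0 y

theorem uEnv_le_iff {X : Type*} [TopologicalSpace X] {g : X → ℝ} {C : ℝ} (h0 : ∀ y, 0 ≤ g y)
    (hC : ∀ y, g y ≤ C) (x : X) (c : ℝ) :
    uEnv g x ≤ c ↔ ∀ c' > c, ∀ᶠ y in 𝓝 x, g y ≤ c' := by
  have hbdd (V : Set X) : BddAbove (g '' V) := ⟨C, by rintro _ ⟨y, -, rfl⟩; exact hC y⟩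
  constructor
  · intro h c' hc'
    obtain ⟨_, ⟨V, hV, hx, rfl⟩, hlt⟩ := exists_lt_of_csInf_lt
      (s := {c | ∃ V : Set X, IsOpen V ∧ x ∈ V ∧ sSup (g '' V) = c})
      ⟨_, Set.univ, isOpen_univ, mem_univ x, rfl⟩ (lt_of_le_of_lt h hc')
    filter_upwards [hV.mem_nhds hx] with y hy
    exact (le_csSup (hbdd V) (mem_image_of_mem g hy)).trans hlt.le
  · intro h
    refine le_of_forall_gt_imp_ge_of_dense fun c' hc' => ?_
    obtain ⟨V, hVg, hV, hx⟩ := eventually_nhds_iff.1 (h c' hc')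
    have hsup : sSup (g '' V) ≤ c' := by
      refine csSup_le ⟨_, mem_image_of_mem g hx⟩ ?_
      rintro _ ⟨y, hy, rfl⟩
      exact hVg y hy
    refine (csInf_le (s := {c | ∃ V : Set X, IsOpen V ∧ x ∈ V ∧ sSup (g '' V) = c})
      ⟨0, ?_⟩ ⟨V, hV, hx, rfl⟩).trans hsup
    rintro _ ⟨V', -, -, rfl⟩
    refine Real.sSup_nonneg ?_
    rintro _ ⟨y, -, rfl⟩
    exact h0 y

theorem uEnv_le_of_le {X : Type*} [TopologicalSpace X] {g : X → ℝ} {C : ℝ} (h0 : ∀ y, 0 ≤ g y)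
    (hC : ∀ y, g y ≤ C) (x : X) : uEnv g x ≤ C :=
  (uEnv_le_iff h0 hC x C).2 fun _ hc => Eventually.of_forall fun y => (hC y).trans hc.le

/-- The pointwise maximum of a finite family of functions on subsets, extended by zero. -/
def iSupExtend {X ι : Type*} (W : ι → Set X) (g : ∀ i, W i → ℝ) (x : X) : ℝ :=
  ⨆ i, if h : x ∈ W i then g i ⟨x, h⟩ else 0

theorem iSupExtend_nonneg {X ι : Type*} {W : ι → Set X} {g : ∀ i, W i → ℝ}
    (h0 : ∀ i y, 0 ≤ g i y) (x : X) : 0 ≤ iSupExtend W g x := by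
  refine Real.iSup_nonneg fun i => ?_
  split_ifs with h
  exacts [h0 i _, le_rfl]

theorem iSupExtend_le_iff {X ι : Type*} [Finite ι] {W : ι → Set X} {g : ∀ i, W i → ℝ}
    (x : X) {c : ℝ} (hc : 0 ≤ c) :
    iSupExtend W g x ≤ c ↔ ∀ i, ∀ h : x ∈ W i, g i ⟨x, h⟩ ≤ c := by
  constructor
  · intro hle i h
    have hi := le_ciSup (f := fun i => if h : x ∈ W i then g i ⟨x, h⟩ else 0)
      (Set.finite_range _).bddAbove i
    simp only [h, dite_true] at hi
    exact hi.trans hle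
  · intro hle
    refine Real.iSup_le (fun i => ?_) hc
    split_ifs with h
    exacts [hle i h, hc]

/-- The upper envelope commutes with finite maxima of zero-extensions from closed sets. -/
theorem uEnv_iSupExtend {X ι : Type*} [TopologicalSpace X] [Finite ι] {W : ι → Set X}
    (hcl : ∀ i, IsClosed (W i)) {g : ∀ i, W i → ℝ} {C : ℝ} (hC0 : 0 ≤ C)
    (h0 : ∀ i y, 0 ≤ g i y) (hC : ∀ i y, g i y ≤ C) (x : X) :
    uEnv (iSupExtend W g) x = iSupExtend W (fun i => uEnv (g i)) x := by
  refine eq_of_forall_ge_iff fun c => ?_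
  have hn := uEnv_nonneg (iSupExtend_nonneg h0) x
  have hn' := iSupExtend_nonneg (fun i => uEnv_nonneg (h0 i)) x
  rcases lt_or_ge c 0 with hc | hc
  · exact iff_of_false (by linarith) (by linarith)
  rw [uEnv_le_iff (iSupExtend_nonneg h0)
    (fun y => (iSupExtend_le_iff y hC0).2 fun i h => hC i _), iSupExtend_le_iff x hc]
  simp only [fun i => uEnv_le_iff (h0 i) (hC i)]
  constructor
  · intro H i h c' hc'
    filter_upwards [continuous_subtype_val.continuousAt.eventually (H c' hc')] with y hy
    exact (iSupExtend_le_iff _ (hc.trans hc'.le)).1 hy i y.2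
  · intro H c' hc'
    have key : ∀ i, ∀ᶠ y in 𝓝 x, ∀ h : y ∈ W i, g i ⟨y, h⟩ ≤ c' := by
      intro i
      by_cases h : x ∈ W i
      · have := H i h c' hc'
        rw [nhds_subtype, eventually_comap] at this
        filter_upwards [this] with y hy hyW
        exact hy ⟨y, hyW⟩ rfl
      · filter_upwards [(hcl i).isOpen_compl.mem_nhds h] with y hy hyW
        exact absurd hyW hy
    filter_upwards [eventually_all.2 key] with y hy
    exact (iSupExtend_le_iff y (hc.trans hc'.le)).2 hy

theorem iSupExtend_restrict {X ι : Type*} [Finite ι] {W : ι → Set X}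
    (hcover : (⋃ i, W i) = Set.univ) {g : X → ℝ} (h0 : ∀ y, 0 ≤ g y) :
    iSupExtend W (fun i => (W i).restrict g) = g := by
  funext y
  refine le_antisymm ((iSupExtend_le_iff y (h0 y)).2 fun _ _ => le_rfl) ?_
  obtain ⟨i, hi⟩ := mem_iUnion.1 (hcover ▸ mem_univ y)
  exact (iSupExtend_le_iff y (iSupExtend_nonneg (fun i z => h0 z) y)).1 le_rfl i hi

theorem losc_eq_iSupExtend {X ι : Type*} [TopologicalSpace X] [Finite ι] {W : ι → Set X}
    (hcl : ∀ i, IsClosed (W i)) (hcover : (⋃ i, W i) = Set.univ) {f : X → ℝ} {C : ℝ}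
    (hC0 : 0 ≤ C) (hC : ∀ x y, |f y - f x| ≤ C) :
    losc f = iSupExtend W (fun i => losc ((W i).restrict f)) := by
  funext x
  change uEnv (fun y => |f y - f x|) x = _
  rw [← iSupExtend_restrict hcover (g := fun y => |f y - f x|) (fun y => abs_nonneg _)]
  exact uEnv_iSupExtend hcl hC0 (fun _ _ => abs_nonneg _) (fun _ _ => hC _ _) x

/-- **Lemma 2.9.** If `K = W_1 ∪ ⋯ ∪ W_n` with each `W_i` closed and non-empty,
then `osc f = max_i (osc (f|_{W_i})) χ_{W_i}`. -/
theorem osc_eq_max_of_closed_cover {K : Type*} [MetricSpace K]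
    [TopologicalSpace.SeparableSpace K] (n : ℕ) (hn : 0 < n)
    (W : Fin n → Set K) (hcl : ∀ i, IsClosed (W i)) (hne : ∀ i, (W i).Nonempty)
    (hcover : (⋃ i, W i) = Set.univ) (f : K → ℝ) (hb : BddFun f) :
    ∀ x : K, osc f x =
      ⨆ i : Fin n, (if h : x ∈ W i then osc ((W i).restrict f) ⟨x, h⟩ else 0) := by
  intro x
  obtain ⟨C, hC⟩ := hb
  have hC' (x y : K) : |f y - f x| ≤ C + C :=
    (abs_sub _ _).trans (add_le_add (hC y) (hC x))
  have hC0 : 0 ≤ C + C := (abs_nonneg _).trans (hC' x x)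
  rw [osc, losc_eq_iSupExtend hcl hcover hC0 hC']
  exact uEnv_iSupExtend hcl hC0
    (fun _ y => uEnv_nonneg (fun _ => abs_nonneg _) y)
    (fun _ y => uEnv_le_of_le (fun _ => abs_nonneg _) (fun _ => hC' _ _) y) x
end
end
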